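/- Let (M,g) be asymptotically hyperbolic with g = ḡ + e, |e|_ḡ + |∇̄e|_ḡ + |∇̄∇̄e|_ḡ = O(e^{-τr}), τ > 3/2, and V = 1/x³. Let F be a face of a polyhedron in the upper half space lying in a Euclidean plane with normal a (so ∂_ν̄V = -a³V and Ā = -a³ ḡ|_F). Then along F: 𝕌(ν̄) = 2V(H̄ - H) - div_F(VX) + O(e^{(-2τ+1)r}), where 𝕌 = V div e - V d(tr_ḡ e) + (tr_ḡ e) dV - e(∇̄V, ·), H and H̄ are the mean curvatures of F in g and ḡ respectively, and X is the vector field on F dual (w.r.t. ḡ|_F) to the 1-form e(ν̄, ·) restricted to F. -/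

import Mathlib

open Real MeasureTheory Filter Topology Matrix

noncomputable section

/-- Euclidean dot product on `ℝ³`. -/
def dot3 (u v : Fin 3 → ℝ) : ℝ := ∑ i, u i * v i

/-- Euclidean norm on `ℝ³`. -/
def enorm3 (u : Fin 3 → ℝ) : ℝ := Real.sqrt (dot3 u u)

/-- Hyperbolic length of a path in the upper half space model `ḡ = (x³)⁻² δ`. -/
def hLength (γ : ℝ → (Fin 3 → ℝ)) : ℝ :=
  ∫ t in (0:ℝ)..1, enorm3 (deriv γ t) / γ t 2

/-- Hyperbolic distance between two points of the upper half space. -/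
def hDist (p q : Fin 3 → ℝ) : ℝ :=
  sInf { L | ∃ γ : ℝ → (Fin 3 → ℝ), γ 0 = p ∧ γ 1 = q ∧ ContDiff ℝ 1 γ ∧
      (∀ t, 0 < γ t 2) ∧ L = hLength γ }

/-- The base point `o = (0,0,1)`. -/
def o3 : Fin 3 → ℝ := ![0, 0, 1]

/-- Christoffel symbols `Γ^k_{ij}` of the hyperbolic metric `ḡ = (x³)⁻² δ`. -/
def ΓH (x : Fin 3 → ℝ) (i j k : Fin 3) : ℝ :=
  -(1 / x 2) * ((if i = 2 then (1:ℝ) else 0) * (if j = k then 1 else 0)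
    + (if j = 2 then (1:ℝ) else 0) * (if i = k then 1 else 0)
    - (if i = j then (1:ℝ) else 0) * (if k = 2 then 1 else 0))

/-- First `ḡ`-covariant derivative of a 2-tensor field:
`(∇̄e)_{kij} = ∂_k e_{ij} - Γ^l_{ki} e_{lj} - Γ^l_{kj} e_{il}`. -/
def cov1 (e : (Fin 3 → ℝ) → Matrix (Fin 3) (Fin 3) ℝ) (x : Fin 3 → ℝ)
    (k i j : Fin 3) : ℝ :=
  fderiv ℝ (fun y => e y i j) x (Pi.single k 1)
    - ∑ l, ΓH x k i l * e x l j - ∑ l, ΓH x k j l * e x i l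

/-- Second `ḡ`-covariant derivative of a 2-tensor field. -/
def cov2 (e : (Fin 3 → ℝ) → Matrix (Fin 3) (Fin 3) ℝ) (x : Fin 3 → ℝ)
    (l k i j : Fin 3) : ℝ :=
  fderiv ℝ (fun y => cov1 e y k i j) x (Pi.single l 1)
    - ∑ m, ΓH x l k m * cov1 e x m i j
    - ∑ m, ΓH x l i m * cov1 e x k m j
    - ∑ m, ΓH x l j m * cov1 e x k i m

/-- Pointwise `ḡ`-norm of a 2-tensor field. -/
def normE (e : (Fin 3 → ℝ) → Matrix (Fin 3) (Fin 3) ℝ) (x : Fin 3 → ℝ) : ℝ :=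
  Real.sqrt (∑ i, ∑ j, ((x 2) ^ 2 * e x i j) ^ 2)

/-- Pointwise `ḡ`-norm of `∇̄e`. -/
def normDE (e : (Fin 3 → ℝ) → Matrix (Fin 3) (Fin 3) ℝ) (x : Fin 3 → ℝ) : ℝ :=
  Real.sqrt (∑ k, ∑ i, ∑ j, ((x 2) ^ 3 * cov1 e x k i j) ^ 2)

/-- Pointwise `ḡ`-norm of `∇̄∇̄e`. -/
def normDDE (e : (Fin 3 → ℝ) → Matrix (Fin 3) (Fin 3) ℝ) (x : Fin 3 → ℝ) : ℝ :=
  Real.sqrt (∑ l, ∑ k, ∑ i, ∑ j, ((x 2) ^ 4 * cov2 e x l k i j) ^ 2)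

/-- Components of the mass integrand 1-form
`𝕌 = V div_ḡ e - V d(tr_ḡ e) + (tr_ḡ e) dV - e(∇̄V, ·)` with `V = 1/x³`
(`(div_ḡ e)_j = ḡ^{ik}(∇̄e)_{ikj}`, `∇̄V = (0,0,-1)`, `dV_j = -δ_{j3}/(x³)²`). -/
def Ucomp (e : (Fin 3 → ℝ) → Matrix (Fin 3) (Fin 3) ℝ) (x : Fin 3 → ℝ) (j : Fin 3) : ℝ :=
  (1 / x 2) * ((x 2) ^ 2 * ∑ k, cov1 e x k k j)
    - (1 / x 2) * fderiv ℝ (fun y => (y 2) ^ 2 * ∑ i, e y i i) x (Pi.single j 1)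
    + ((x 2) ^ 2 * ∑ i, e x i i) * (if j = 2 then -((x 2) ^ 2)⁻¹ else 0)
    + e x 2 j

/-- `𝕌(ν̄)` where `ν̄ = x³ a` is the `ḡ`-unit normal of the face. -/
def UNu (e : (Fin 3 → ℝ) → Matrix (Fin 3) (Fin 3) ℝ) (a x : Fin 3 → ℝ) : ℝ :=
  ∑ j, Ucomp e x j * (x 2 * a j)

/-- The matrix of `g = ḡ + e` at `x`. -/
def gMatrix (e : (Fin 3 → ℝ) → Matrix (Fin 3) (Fin 3) ℝ) (x : Fin 3 → ℝ) :
    Matrix (Fin 3) (Fin 3) ℝ :=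
  Matrix.of fun i j => (if i = j then ((x 2) ^ 2)⁻¹ else 0) + e x i j

/-- The matrix of the hyperbolic metric `ḡ` at `x`. -/
def gbarMatrix (x : Fin 3 → ℝ) : Matrix (Fin 3) (Fin 3) ℝ :=
  Matrix.of fun i j => if i = j then ((x 2) ^ 2)⁻¹ else 0

/-- Divergence of a vector field w.r.t. the metric with matrix field `Gf`:
`div Y = ∂_i Y^i + Y^i ∂_i log √(det G)`. -/
def divg (Gf : (Fin 3 → ℝ) → Matrix (Fin 3) (Fin 3) ℝ)
    (Y : (Fin 3 → ℝ) → (Fin 3 → ℝ)) (x : Fin 3 → ℝ) : ℝ :=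
  (∑ i, fderiv ℝ (fun y => Y y i) x (Pi.single i 1))
    + ∑ i, Y x i * fderiv ℝ (fun y => Real.log (Real.sqrt ((Gf y).det))) x (Pi.single i 1)

/-- Mean curvature of the (planes parallel to the) face with Euclidean conormal `a`
in the metric with matrix field `Gf`: the divergence of the unit normal field
`ν = G⁻¹ a / √(a·G⁻¹a)`. -/
def meanCurv (Gf : (Fin 3 → ℝ) → Matrix (Fin 3) (Fin 3) ℝ) (a : Fin 3 → ℝ)
    (x : Fin 3 → ℝ) : ℝ :=
  divg Gf (fun y => (Real.sqrt (a ⬝ᵥ ((Gf y)⁻¹).mulVec a))⁻¹ • ((Gf y)⁻¹).mulVec a) x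

/-- The components of the tangent field `X` dual (w.r.t. `b = ḡ|_F`) to `e(ν̄,·)|_F`
in the Euclidean orthonormal tangent frame `t`: `X^α = (x³)³ ∑ aᵢ e_{ij} t_α^j`. -/
def Xcomp (e : (Fin 3 → ℝ) → Matrix (Fin 3) (Fin 3) ℝ) (a t x : Fin 3 → ℝ) : ℝ :=
  (x 2) ^ 3 * ∑ i, ∑ j, a i * e x i j * t j

/-- Intrinsic divergence `div_F(V X)` on the face `F` (with induced metric
`b = (x³)⁻² δ₂`): `div_b W = (x³)² ∂_α((x³)⁻² W^α)` over a Euclidean orthonormal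
tangent frame `t₁, t₂` of `F`. -/
def divFVX (e : (Fin 3 → ℝ) → Matrix (Fin 3) (Fin 3) ℝ) (a t₁ t₂ x : Fin 3 → ℝ) : ℝ :=
  (x 2) ^ 2 *
    (fderiv ℝ (fun y => ((y 2) ^ 2)⁻¹ * (1 / y 2) * Xcomp e a t₁ y) x t₁
      + fderiv ℝ (fun y => ((y 2) ^ 2)⁻¹ * (1 / y 2) * Xcomp e a t₂ y) x t₂)

lemma dot3_self_nonneg (u : Fin 3 → ℝ) : 0 ≤ dot3 u u :=
  Finset.sum_nonneg fun i _ => mul_self_nonneg (u i)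

/-- The function `log ((|x|² + 1) / x³)` is `1`-Lipschitz for the hyperbolic metric. -/
lemma log_deriv_le_enorm3 (u v : Fin 3 → ℝ) (hu : 0 < u 2) :
    2 * dot3 u v / (dot3 u u + 1) - v 2 / u 2 ≤ enorm3 v / u 2 := by
  have hs : 0 < dot3 u u + 1 := by linarith [dot3_self_nonneg u]
  have key : 2 * u 2 * dot3 u v / (dot3 u u + 1) - v 2 ≤ enorm3 v := by
    refine Real.le_sqrt_of_sq_le ?_
    set s := dot3 u u + 1 with hsdef
    set k := 2 * u 2 / s with hk
    have hks : k * s = 2 * u 2 := by rw [hk]; field_simp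
    have e1 : 2 * u 2 * dot3 u v / s - v 2 = k * dot3 u v - v 2 := by rw [hk]; ring
    rw [e1]
    have hw : k ^ 2 * (s - 1) - 2 * k * u 2 ≤ 0 := by
      have : 2 * k * u 2 = k ^ 2 * s := by linear_combination -k * hks
      nlinarith [sq_nonneg k]
    have hss : s - 1 = u 0 ^ 2 + u 1 ^ 2 + u 2 ^ 2 := by
      simp only [hsdef, dot3, Fin.sum_univ_three]; ring
    rw [hss] at hw
    have hV : 0 ≤ v 0 ^ 2 + v 1 ^ 2 + v 2 ^ 2 := by positivity
    simp only [dot3, Fin.sum_univ_three]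
    nlinarith [mul_nonneg hV (neg_nonneg.2 hw), sq_nonneg (k * u 0 * v 1 - k * u 1 * v 0),
      sq_nonneg (k * u 0 * v 2 - (k * u 2 - 1) * v 0),
      sq_nonneg (k * u 1 * v 2 - (k * u 2 - 1) * v 1)]
  have : 2 * dot3 u v / (dot3 u u + 1) - v 2 / u 2
      = (2 * u 2 * dot3 u v / (dot3 u u + 1) - v 2) / u 2 := by
    field_simp
  rw [this]
  gcongr

lemma log_le_hLength (γ : ℝ → (Fin 3 → ℝ)) (hγ : ContDiff ℝ 1 γ) (hpos : ∀ t, 0 < γ t 2) :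
    (Real.log (dot3 (γ 1) (γ 1) + 1) - Real.log (γ 1 2))
      - (Real.log (dot3 (γ 0) (γ 0) + 1) - Real.log (γ 0 2)) ≤ hLength γ := by
  have hd : ∀ t, HasDerivAt γ (deriv γ t) t := fun t =>
    ((hγ.differentiable one_ne_zero) t).hasDerivAt
  have hdi : ∀ i t, HasDerivAt (fun t => γ t i) (deriv γ t i) t := fun i t =>
    (hasDerivAt_pi.1 (hd t)) i
  have hcd : Continuous (deriv γ) := hγ.continuous_deriv le_rfl
  have hc : Continuous γ := hγ.continuous
  have hcdi : ∀ i, Continuous fun t => deriv γ t i := fun i => (continuous_apply i).comp hcd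
  have hci : ∀ i, Continuous fun t => γ t i := fun i => (continuous_apply i).comp hc
  have hs : ∀ t, dot3 (γ t) (γ t) + 1 ≠ 0 := fun t => by
    linarith [dot3_self_nonneg (γ t)] |> ne_of_gt
  have hdot : ∀ t, HasDerivAt (fun t => dot3 (γ t) (γ t) + 1)
      (2 * dot3 (γ t) (deriv γ t)) t := by
    intro t
    have := (((hdi 0 t).mul (hdi 0 t)).add ((hdi 1 t).mul (hdi 1 t))).add
      ((hdi 2 t).mul (hdi 2 t)) |>.add_const 1
    simp only [dot3, Fin.sum_univ_three]
    exact this.congr_deriv (by ring)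
  have hφ : ∀ t ∈ Set.uIcc (0:ℝ) 1,
      HasDerivAt (fun t => Real.log (dot3 (γ t) (γ t) + 1) - Real.log (γ t 2))
      (2 * dot3 (γ t) (deriv γ t) / (dot3 (γ t) (γ t) + 1) - deriv γ t 2 / γ t 2) t :=
    fun t _ => ((hdot t).log (hs t)).sub ((hdi 2 t).log (hpos t).ne')
  have hc1 : Continuous fun t =>
      2 * dot3 (γ t) (deriv γ t) / (dot3 (γ t) (γ t) + 1) - deriv γ t 2 / γ t 2 := by
    refine Continuous.sub (Continuous.div ?_ ?_ hs) ((hcdi 2).div (hci 2) fun t => (hpos t).ne')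
    · simp only [dot3]; fun_prop
    · simp only [dot3]; fun_prop
  have hc2 : Continuous fun t => enorm3 (deriv γ t) / γ t 2 := by
    refine Continuous.div ?_ (hci 2) fun t => (hpos t).ne'
    simp only [enorm3, dot3]; fun_prop
  rw [← intervalIntegral.integral_eq_sub_of_hasDerivAt hφ (hc1.intervalIntegrable 0 1)]
  exact intervalIntegral.integral_mono_on zero_le_one (hc1.intervalIntegrable 0 1)
    (hc2.intervalIntegrable 0 1) fun t _ => log_deriv_le_enorm3 _ _ (hpos t)

/-- `2 cosh r = (|x|² + 1) / x³ ≤ 2 eʳ`. -/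
lemma dot3_add_one_le (x : Fin 3 → ℝ) (hx : 0 < x 2) :
    dot3 x x + 1 ≤ 2 * x 2 * Real.exp (hDist o3 x) := by
  have hs : 0 < dot3 x x + 1 := by linarith [dot3_self_nonneg x]
  have key : Real.log (dot3 x x + 1) - Real.log (x 2) - Real.log 2 ≤ hDist o3 x := by
    refine le_csInf ?_ ?_
    · refine ⟨_, fun t => ![t * x 0, t * x 1, Real.exp (t * Real.log (x 2))], ?_, ?_, ?_, ?_, rfl⟩
      · ext i; fin_cases i <;> simp [o3]
      · ext i; fin_cases i <;> simp [Real.exp_log hx]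
      · rw [contDiff_pi]
        intro i
        fin_cases i <;> simp <;> fun_prop
      · intro t; simp [Real.exp_pos]
    · rintro L ⟨γ, h0, h1, hγ, hpos, rfl⟩
      have := log_le_hLength γ hγ hpos
      rw [h0, h1] at this
      have h2 : dot3 o3 o3 + 1 = 2 := by simp [dot3, o3, Fin.sum_univ_three]; norm_num
      have h3 : o3 2 = 1 := by simp [o3]
      rw [h2, h3, Real.log_one] at this
      linarith
  rw [← Real.log_div hs.ne' hx.ne', ← Real.log_div (by positivity) two_ne_zero,
    Real.log_le_iff_le_exp (by positivity), div_div, div_le_iff₀ (by positivity)] at key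
  linarith

lemma hDist_nonneg (x : Fin 3 → ℝ) (hx : 0 < x 2) : 0 ≤ hDist o3 x := by
  have h := dot3_add_one_le x hx
  have h2 : 2 * x 2 ≤ dot3 x x + 1 := by
    simp only [dot3, Fin.sum_univ_three]
    nlinarith [sq_nonneg (x 2 - 1), sq_nonneg (x 0), sq_nonneg (x 1)]
  rw [← Real.one_le_exp_iff]
  nlinarith

lemma one_div_le_exp_hDist (x : Fin 3 → ℝ) (hx : 0 < x 2) :
    1 / x 2 ≤ 2 * Real.exp (hDist o3 x) := by
  have h := dot3_add_one_le x hx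
  rw [div_le_iff₀ hx]
  nlinarith [dot3_self_nonneg x]

lemma hasDerivAt_line {E : Type*} [NormedAddCommGroup E] [NormedSpace ℝ E] {f : E → ℝ} {x : E}
    (hf : DifferentiableAt ℝ f x) (v : E) :
    HasDerivAt (fun s : ℝ => f (x + s • v)) (fderiv ℝ f x v) 0 :=
  hf.hasFDerivAt.hasLineDerivAt v

section MatrixField

variable {E : Type*} [NormedAddCommGroup E] [NormedSpace ℝ E]
  {F : E → Matrix (Fin 3) (Fin 3) ℝ} {x : E}

/-- Entrywise directional derivative of a matrix field. -/
def matDeriv (F : E → Matrix (Fin 3) (Fin 3) ℝ) (x v : E) : Matrix (Fin 3) (Fin 3) ℝ :=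
  Matrix.of fun i j => fderiv ℝ (fun y => F y i j) x v

lemma differentiableAt_det (hF : ∀ i j, DifferentiableAt ℝ (fun y => F y i j) x) :
    DifferentiableAt ℝ (fun y => (F y).det) x := by
  simp only [det_fin_three]
  fun_prop

lemma differentiableAt_inv_apply (hF : ∀ i j, DifferentiableAt ℝ (fun y => F y i j) x)
    (hdet : (F x).det ≠ 0) (i j : Fin 3) : DifferentiableAt ℝ (fun y => (F y)⁻¹ i j) x := by
  have hd := differentiableAt_det hF
  have : (fun y => (F y)⁻¹ i j) = fun y => ((F y).det)⁻¹ * (F y).adjugate i j := by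
    ext y
    simp [inv_def]
  rw [this]
  refine (hd.fun_inv hdet).fun_mul ?_
  fin_cases i <;> fin_cases j <;> simp [adjugate_fin_three] <;> fun_prop

lemma differentiableAt_inv_mulVec (hF : ∀ i j, DifferentiableAt ℝ (fun y => F y i j) x)
    (hdet : (F x).det ≠ 0) (a : Fin 3 → ℝ) (i : Fin 3) :
    DifferentiableAt ℝ (fun y => ((F y)⁻¹ *ᵥ a) i) x :=
  DifferentiableAt.fun_sum (u := Finset.univ) fun j _ =>
    (differentiableAt_inv_apply hF hdet i j).mul_const (a j)

lemma fderiv_inv_mulVec (hF : ∀ i j, DifferentiableAt ℝ (fun y => F y i j) x)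
    (hdet : (F x).det ≠ 0) (a : Fin 3 → ℝ) (v : E) (i : Fin 3) :
    fderiv ℝ (fun y => ((F y)⁻¹ *ᵥ a) i) x v
      = -((F x)⁻¹ *ᵥ (matDeriv F x v *ᵥ ((F x)⁻¹ *ᵥ a))) i := by
  have hw := differentiableAt_inv_mulVec hF hdet a
  set w' : Fin 3 → ℝ := fun i => fderiv ℝ (fun y => ((F y)⁻¹ *ᵥ a) i) x v with hw'
  have hunit : IsUnit (F x).det := hdet.isUnit
  have hev : ∀ᶠ y in 𝓝 x, F y *ᵥ ((F y)⁻¹ *ᵥ a) = a := by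
    filter_upwards [(differentiableAt_det hF).continuousAt.eventually_ne hdet] with y hy
    rw [mulVec_mulVec, mul_nonsing_inv _ (Ne.isUnit hy), one_mulVec]
  have key : matDeriv F x v *ᵥ ((F x)⁻¹ *ᵥ a) + F x *ᵥ w' = 0 := by
    ext k
    have h1 : HasDerivAt (fun s : ℝ => (F (x + s • v) *ᵥ ((F (x + s • v))⁻¹ *ᵥ a)) k)
        ((matDeriv F x v *ᵥ ((F x)⁻¹ *ᵥ a) + F x *ᵥ w') k) 0 := by
      have := HasDerivAt.fun_sum (u := Finset.univ) fun j (_ : j ∈ Finset.univ) =>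
        (hasDerivAt_line (hF k j) v).fun_mul (hasDerivAt_line (hw j) v)
      refine this.congr_deriv ?_
      simp [matDeriv, hw', mulVec, dotProduct, Finset.sum_add_distrib, -mulVec_mulVec]
    have htend : Tendsto (fun s : ℝ => x + s • v) (𝓝 0) (𝓝 x) := by
      have : Continuous fun s : ℝ => x + s • v := by fun_prop
      simpa using this.tendsto 0
    have h2 : HasDerivAt (fun s : ℝ => (F (x + s • v) *ᵥ ((F (x + s • v))⁻¹ *ᵥ a)) k) 0 0 := by
      refine (hasDerivAt_const (0:ℝ) (a k)).congr_of_eventuallyEq ?_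
      filter_upwards [htend.eventually hev] with s hs
      rw [hs]
    exact h1.unique h2
  have h3 : w' = -((F x)⁻¹ *ᵥ (matDeriv F x v *ᵥ ((F x)⁻¹ *ᵥ a))) := by
    rw [eq_neg_of_add_eq_zero_left key, mulVec_neg, mulVec_mulVec, nonsing_inv_mul _ hunit,
      one_mulVec, neg_neg]
  exact congrFun h3 i

lemma fderiv_log_sqrt_det (hF : ∀ i j, DifferentiableAt ℝ (fun y => F y i j) x)
    (hdet : 0 < (F x).det) (v : E) :
    fderiv ℝ (fun y => Real.log (Real.sqrt (F y).det)) x v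
      = 1 / 2 * ((F x)⁻¹ * matDeriv F x v).trace := by
  have hdd := differentiableAt_det hF
  have hds : DifferentiableAt ℝ (fun y => Real.log (Real.sqrt (F y).det)) x :=
    (hdd.sqrt hdet.ne').log (Real.sqrt_pos.2 hdet).ne'
  have hx : x + (0:ℝ) • v = x := by simp
  have hdet' : fderiv ℝ (fun y => (F y).det) x v = ((F x).adjugate * matDeriv F x v).trace := by
    have h1 := hasDerivAt_line hdd v
    have hl := fun i j => hasDerivAt_line (hF i j) v
    have h2 := (((((((hl 0 0).fun_mul (hl 1 1)).fun_mul (hl 2 2)).fun_sub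
      (((hl 0 0).fun_mul (hl 1 2)).fun_mul (hl 2 1))).fun_sub
      (((hl 0 1).fun_mul (hl 1 0)).fun_mul (hl 2 2))).fun_add
      (((hl 0 1).fun_mul (hl 1 2)).fun_mul (hl 2 0))).fun_add
      (((hl 0 2).fun_mul (hl 1 0)).fun_mul (hl 2 1))).fun_sub
      (((hl 0 2).fun_mul (hl 1 1)).fun_mul (hl 2 0))
    simp only [← det_fin_three] at h2
    rw [h1.unique h2]
    simp only [hx, adjugate_fin_three, trace_fin_three, mul_apply, Fin.sum_univ_three, matDeriv,
      Matrix.of_apply, Matrix.cons_val]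
    ring
  have h1 := hasDerivAt_line hds v
  have h2 := ((hasDerivAt_line hdd v).sqrt (by simpa using hdet.ne')).log
    (by simpa using (Real.sqrt_pos.2 hdet).ne')
  rw [h1.unique h2, hdet', hx, div_div, mul_assoc, Real.mul_self_sqrt hdet.le, inv_def,
    Ring.inverse_eq_inv', smul_mul, trace_smul, smul_eq_mul]
  field_simp

end MatrixField

/-- First variation form of the mean curvature of the planes with conormal `a`. -/
lemma meanCurv_eq (Gf : (Fin 3 → ℝ) → Matrix (Fin 3) (Fin 3) ℝ) (a x : Fin 3 → ℝ)
    (hF : ∀ i j, DifferentiableAt ℝ (fun y => Gf y i j) x) (hG : (Gf x).PosDef) (ha : a ≠ 0) :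
    meanCurv Gf a x = ∑ i, (-((√(a ⬝ᵥ (Gf x)⁻¹ *ᵥ a))⁻¹ *
        ((Gf x)⁻¹ *ᵥ (matDeriv Gf x (Pi.single i 1) *ᵥ ((Gf x)⁻¹ *ᵥ a))) i)
      + 1 / 2 * (√(a ⬝ᵥ (Gf x)⁻¹ *ᵥ a))⁻¹ ^ 3 * ((Gf x)⁻¹ *ᵥ a) i *
        (((Gf x)⁻¹ *ᵥ a) ⬝ᵥ (matDeriv Gf x (Pi.single i 1) *ᵥ ((Gf x)⁻¹ *ᵥ a)))
      + 1 / 2 * (√(a ⬝ᵥ (Gf x)⁻¹ *ᵥ a))⁻¹ * ((Gf x)⁻¹ *ᵥ a) i *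
        ((Gf x)⁻¹ * matDeriv Gf x (Pi.single i 1)).trace) := by
  have hdet : 0 < (Gf x).det := hG.det_pos
  have hq : 0 < a ⬝ᵥ (Gf x)⁻¹ *ᵥ a := by simpa using hG.inv.dotProduct_mulVec_pos ha
  have hsymm : ∀ u, a ⬝ᵥ (Gf x)⁻¹ *ᵥ u = ((Gf x)⁻¹ *ᵥ a) ⬝ᵥ u := fun u => by
    have := hG.inv.isHermitian
    rw [IsHermitian, conjTranspose_eq_transpose_of_trivial] at this
    rw [dotProduct_mulVec, ← mulVec_transpose, this]
  have hw := differentiableAt_inv_mulVec hF hdet.ne' a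
  have hdq : DifferentiableAt ℝ (fun y => a ⬝ᵥ (Gf y)⁻¹ *ᵥ a) x := by
    simp only [dotProduct]
    fun_prop
  rw [meanCurv, divg, ← Finset.sum_add_distrib]
  refine Finset.sum_congr rfl fun i _ => ?_
  set v : Fin 3 → ℝ := Pi.single i 1
  have hx : x + (0:ℝ) • v = x := by simp
  rw [fderiv_log_sqrt_det hF hdet]
  have hq' : fderiv ℝ (fun y => a ⬝ᵥ (Gf y)⁻¹ *ᵥ a) x v
      = -(((Gf x)⁻¹ *ᵥ a) ⬝ᵥ (matDeriv Gf x v *ᵥ ((Gf x)⁻¹ *ᵥ a))) := by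
    have h1 := hasDerivAt_line hdq v
    have h2 : HasDerivAt (fun s : ℝ => a ⬝ᵥ (Gf (x + s • v))⁻¹ *ᵥ a) _ 0 :=
      HasDerivAt.fun_sum (u := Finset.univ) fun j (_ : j ∈ Finset.univ) =>
        (hasDerivAt_line (hw j) v).const_mul (a j)
    rw [h1.unique h2, ← hsymm]
    simp only [fderiv_inv_mulVec hF hdet.ne', dotProduct, mul_neg, Finset.sum_neg_distrib]
  have hdiv : DifferentiableAt ℝ
      (fun y => ((√(a ⬝ᵥ (Gf y)⁻¹ *ᵥ a))⁻¹ • (Gf y)⁻¹ *ᵥ a) i) x :=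
    ((hdq.sqrt hq.ne').fun_inv (Real.sqrt_pos.2 hq).ne').fun_mul (hw i)
  have h1 := hasDerivAt_line hdiv v
  have h2 := (((hasDerivAt_line hdq v).sqrt (by simpa using hq.ne')).fun_inv
    (by simpa using (Real.sqrt_pos.2 hq).ne')).fun_mul (hasDerivAt_line (hw i) v)
  rw [h1.unique h2, hq', fderiv_inv_mulVec hF hdet.ne', hx]
  have := (Real.sqrt_pos.2 hq).ne'
  simp only [Pi.smul_apply, smul_eq_mul]
  field_simp
  ring

/-- Components of `e` in the `ḡ`-orthonormal frame `x³ ∂ᵢ`. -/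
def frameE (e : (Fin 3 → ℝ) → Matrix (Fin 3) (Fin 3) ℝ) (x : Fin 3 → ℝ) :
    Matrix (Fin 3) (Fin 3) ℝ :=
  Matrix.of fun i j => (x 2) ^ 2 * e x i j

/-- The derivative `x³ ∂ₖ` of the matrix `frameE e`. -/
def frameDE (e : (Fin 3 → ℝ) → Matrix (Fin 3) (Fin 3) ℝ) (x : Fin 3 → ℝ) (k : Fin 3) :
    Matrix (Fin 3) (Fin 3) ℝ :=
  Matrix.of fun i j => (x 2) ^ 3 * fderiv ℝ (fun y => e y i j) x (Pi.single k 1)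
    + 2 * (if k = 2 then 1 else 0) * ((x 2) ^ 2 * e x i j)

/-- The metric `g` in the `ḡ`-orthonormal frame. -/
def frameG (e : (Fin 3 → ℝ) → Matrix (Fin 3) (Fin 3) ℝ) (x : Fin 3 → ℝ) :
    Matrix (Fin 3) (Fin 3) ℝ :=
  1 + frameE e x

/-- `frameG⁻¹ a`, the unnormalized `g`-normal in the orthonormal frame. -/
def frameW (e : (Fin 3 → ℝ) → Matrix (Fin 3) (Fin 3) ℝ) (a x : Fin 3 → ℝ) : Fin 3 → ℝ :=
  (frameG e x)⁻¹ *ᵥ a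

/-- The factor normalizing `frameW`. -/
def frameS (e : (Fin 3 → ℝ) → Matrix (Fin 3) (Fin 3) ℝ) (a x : Fin 3 → ℝ) : ℝ :=
  (√(a ⬝ᵥ frameW e a x))⁻¹

/-- Coefficient of `frameDE e x k i j` in the mean curvature. -/
def curvCoeff (e : (Fin 3 → ℝ) → Matrix (Fin 3) (Fin 3) ℝ) (a x : Fin 3 → ℝ)
    (k i j : Fin 3) : ℝ :=
  -(frameS e a x * (frameG e x)⁻¹ k i * frameW e a x j)
    + 1 / 2 * (frameS e a x ^ 3 * frameW e a x k * frameW e a x i * frameW e a x j)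
    + 1 / 2 * (frameS e a x * frameW e a x k * (frameG e x)⁻¹ j i)

/-- The value of `curvCoeff` for `e = 0`. -/
def flatCurvCoeff (a : Fin 3 → ℝ) (k i j : Fin 3) : ℝ :=
  -((1 : Matrix (Fin 3) (Fin 3) ℝ) k i * a j) + 1 / 2 * (a k * a i * a j)
    + 1 / 2 * (a k * (1 : Matrix (Fin 3) (Fin 3) ℝ) j i)

section Identities

variable {e : (Fin 3 → ℝ) → Matrix (Fin 3) (Fin 3) ℝ} {a x : Fin 3 → ℝ}

lemma gMatrix_eq_smul (hx : 0 < x 2) : gMatrix e x = ((x 2) ^ 2)⁻¹ • frameG e x := by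
  ext i j
  have := hx.ne'
  simp only [gMatrix, frameG, frameE, Matrix.of_apply, Matrix.smul_apply, Matrix.add_apply,
    Matrix.one_apply, smul_eq_mul]
  split_ifs
  · field_simp
  · field_simp
    ring

lemma gbarMatrix_eq : gbarMatrix = gMatrix 0 := by
  ext x i j
  simp [gbarMatrix, gMatrix]

lemma posDef_frameG (hx : 0 < x 2) (hpos : (gMatrix e x).PosDef) : (frameG e x).PosDef := by
  have h : frameG e x = (x 2) ^ 2 • gMatrix e x := by
    rw [gMatrix_eq_smul hx, smul_smul, mul_inv_cancel₀ (by positivity), one_smul]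
  rw [h]
  exact hpos.smul (by positivity)

lemma gMatrix_inv (hx : 0 < x 2) (hpos : (frameG e x).PosDef) :
    (gMatrix e x)⁻¹ = (x 2) ^ 2 • (frameG e x)⁻¹ := by
  refine inv_eq_left_inv ?_
  rw [gMatrix_eq_smul hx, smul_mul_smul_comm, mul_inv_cancel₀ (by positivity), one_smul,
    nonsing_inv_mul _ hpos.det_pos.ne'.isUnit]

lemma differentiableAt_gMatrix (he : ∀ i j, Differentiable ℝ fun x => e x i j) (hx : 0 < x 2)
    (i j : Fin 3) : DifferentiableAt ℝ (fun y => gMatrix e y i j) x := by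
  have := he i j
  simp only [gMatrix, Matrix.of_apply]
  split_ifs
  · fun_prop (disch := positivity)
  · fun_prop

lemma matDeriv_gMatrix (he : ∀ i j, Differentiable ℝ fun x => e x i j) (hx : 0 < x 2)
    (k : Fin 3) :
    matDeriv (gMatrix e) x (Pi.single k 1)
      = ((x 2) ^ 3)⁻¹ • (frameDE e x k - (2 * (if k = 2 then (1:ℝ) else 0)) • frameG e x) := by
  ext i j
  have h1 := hasDerivAt_line (differentiableAt_gMatrix he hx i j) (Pi.single k 1)
  have hc : HasDerivAt (fun s : ℝ => (x + s • (Pi.single k 1 : Fin 3 → ℝ)) 2)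
      (if k = 2 then 1 else 0) 0 := by
    have := ((hasDerivAt_id (0:ℝ)).mul_const ((Pi.single k 1 : Fin 3 → ℝ) 2)).const_add (x 2)
    exact this.congr_deriv (by simp [Pi.single_apply, eq_comm])
  have hx0 : (x + (0:ℝ) • (Pi.single k 1 : Fin 3 → ℝ)) = x := by simp
  have he1 := hasDerivAt_line (he i j x) (Pi.single k 1)
  have h2 := ((((hc.fun_pow 2).fun_inv (by rw [hx0]; positivity)).const_mul
    (if i = j then (1:ℝ) else 0)).fun_add he1)
  have h3 := h1.unique (h2.congr_of_eventuallyEq (.of_forall fun s => by simp [gMatrix]))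
  simp only [matDeriv, Matrix.of_apply]
  rw [h3, hx0]
  have := hx.ne'
  simp only [frameDE, frameG, frameE, Matrix.smul_apply, Matrix.sub_apply, Matrix.add_apply,
    Matrix.of_apply, smul_eq_mul, Matrix.one_apply]
  field_simp
  ring

lemma dotProduct_frameW_pos (hpos : (frameG e x).PosDef) (ha : a ≠ 0) :
    0 < a ⬝ᵥ frameW e a x := by
  simpa [frameW] using hpos.inv.dotProduct_mulVec_pos ha

lemma meanCurv_gMatrix (he : ∀ i j, Differentiable ℝ fun x => e x i j) (hx : 0 < x 2)
    (hG : (gMatrix e x).PosDef) (ha : a ≠ 0) :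
    meanCurv (gMatrix e) a x = -2 * (frameS e a x * frameW e a x 2)
      + ∑ k, ∑ i, ∑ j, curvCoeff e a x k i j * frameDE e x k i j := by
  have hpos := posDef_frameG hx hG
  have hunit := hpos.det_pos.ne'.isUnit
  have hQ := dotProduct_frameW_pos hpos ha
  rw [meanCurv_eq _ a x (differentiableAt_gMatrix he hx) hG ha, gMatrix_inv hx hpos]
  simp only [matDeriv_gMatrix he hx]
  have hsq : √(a ⬝ᵥ ((x 2) ^ 2 • frameW e a x)) = x 2 * √(a ⬝ᵥ frameW e a x) := by
    rw [dotProduct_smul, smul_eq_mul, Real.sqrt_mul (by positivity), Real.sqrt_sq hx.le]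
  have hS : (√(a ⬝ᵥ frameW e a x))⁻¹ = frameS e a x := rfl
  have hS2 : frameS e a x ^ 2 * (a ⬝ᵥ frameW e a x) = 1 := by
    rw [frameS, inv_pow, Real.sq_sqrt hQ.le, inv_mul_cancel₀ hQ.ne']
  have hMW : frameG e x *ᵥ frameW e a x = a := by
    rw [frameW, mulVec_mulVec, mul_nonsing_inv _ hunit, one_mulVec]
  have hW : ((x 2) ^ 2 • (frameG e x)⁻¹) *ᵥ a = (x 2) ^ 2 • frameW e a x := smul_mulVec ..
  have hWW : (frameG e x)⁻¹ *ᵥ a = frameW e a x := rfl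
  have hterm : ∀ (k : Fin 3) (c : ℝ) (D : Matrix (Fin 3) (Fin 3) ℝ),
      (-((x 2)⁻¹ * frameS e a x * (((x 2) ^ 2 • (frameG e x)⁻¹) *ᵥ
          ((((x 2) ^ 3)⁻¹ • (D - c • frameG e x)) *ᵥ ((x 2) ^ 2 • frameW e a x))) k)
      + 1 / 2 * ((x 2)⁻¹ * frameS e a x) ^ 3 * ((x 2) ^ 2 • frameW e a x) k *
        (((x 2) ^ 2 • frameW e a x) ⬝ᵥ
          ((((x 2) ^ 3)⁻¹ • (D - c • frameG e x)) *ᵥ ((x 2) ^ 2 • frameW e a x)))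
      + 1 / 2 * ((x 2)⁻¹ * frameS e a x) * ((x 2) ^ 2 • frameW e a x) k *
        (((x 2) ^ 2 • (frameG e x)⁻¹) * (((x 2) ^ 3)⁻¹ • (D - c • frameG e x))).trace)
      = -c * (frameS e a x * frameW e a x k) +
        (-(frameS e a x * ((frameG e x)⁻¹ *ᵥ (D *ᵥ frameW e a x)) k)
        + 1 / 2 * frameS e a x ^ 3 * frameW e a x k * (frameW e a x ⬝ᵥ (D *ᵥ frameW e a x))
        + 1 / 2 * frameS e a x * frameW e a x k * ((frameG e x)⁻¹ * D).trace) := by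
    intro k c D
    have hx' := hx.ne'
    simp only [smul_mulVec, mulVec_smul, sub_mulVec, mulVec_sub, hMW, hWW, Pi.smul_apply,
      Pi.sub_apply, smul_eq_mul, dotProduct_smul, smul_dotProduct, dotProduct_sub,
      Matrix.smul_mul, Matrix.mul_smul, trace_smul, Matrix.mul_sub, trace_sub,
      nonsing_inv_mul _ hunit, trace_one, Fintype.card_fin, dotProduct_comm (frameW e a x) a]
    push_cast
    field_simp
    linear_combination (-c * frameS e a x * frameW e a x k) * hS2
  simp only [hW, hsq, mul_inv, hS, hterm]
  rw [Finset.sum_add_distrib]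
  congr 1
  · simp
  · refine Finset.sum_congr rfl fun k _ => ?_
    simp only [curvCoeff, mulVec, dotProduct, trace, diag, mul_apply,
      Fin.sum_univ_three]
    ring

lemma meanCurv_gbarMatrix (hx : 0 < x 2) (ha : dot3 a a = 1) :
    meanCurv gbarMatrix a x = -2 * a 2 := by
  have ha0 : a ≠ 0 := by
    rintro rfl
    simp [dot3] at ha
  have hG1 : frameG 0 x = 1 := by
    ext i j
    simp [frameG, frameE]
  have hG : (gMatrix 0 x).PosDef := by
    rw [gMatrix_eq_smul hx, hG1]
    exact PosDef.one.smul (by positivity)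
  have hW : frameW 0 a x = a := by simp [frameW, hG1]
  have hS : frameS 0 a x = 1 := by
    rw [frameS, hW]
    change (√(dot3 a a))⁻¹ = 1
    simp [ha]
  have hD : ∀ k i j, frameDE 0 x k i j = 0 := by simp [frameDE]
  rw [gbarMatrix_eq, meanCurv_gMatrix (by simp) hx hG ha0, hW, hS]
  simp [hD]

lemma UNu_eq (he : ∀ i j, Differentiable ℝ fun x => e x i j) (hx : 0 < x 2)
    (hsymm : ∀ x i j, e x i j = e x j i) :
    UNu e a x = 1 / x 2 * (∑ k, ∑ i, ∑ j, ((1 : Matrix (Fin 3) (Fin 3) ℝ) k i * a j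
        - a k * (1 : Matrix (Fin 3) (Fin 3) ℝ) j i) * frameDE e x k i j
      - 2 * (frameE e x *ᵥ a) 2) := by
  have htr : ∀ k : Fin 3, fderiv ℝ (fun y => (y 2) ^ 2 * ∑ i, e y i i) x (Pi.single k 1)
      = 2 * x 2 * (if k = 2 then 1 else 0) * (∑ i, e x i i)
        + x 2 ^ 2 * ∑ i, fderiv ℝ (fun y => e y i i) x (Pi.single k 1) := by
    intro k
    have h1 : HasFDerivAt (fun y : Fin 3 → ℝ => y 2)
        (ContinuousLinearMap.proj (R := ℝ) (φ := fun _ : Fin 3 => ℝ) 2) x := hasFDerivAt_apply 2 x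
    have h2 : HasFDerivAt (fun y : Fin 3 → ℝ => (y 2) ^ 2 * ∑ i, e y i i) _ x := (h1.pow 2).mul
      (HasFDerivAt.fun_sum (u := Finset.univ) fun i _ => (he i i x).hasFDerivAt)
    rw [h2.fderiv]
    simp [Pi.single_apply, eq_comm, Fin.sum_univ_three]
    split_ifs <;> ring
  have hx' := hx.ne'
  simp only [UNu, Ucomp, htr]
  simp only [cov1, ΓH, frameDE, frameE, mulVec, dotProduct, Fin.sum_univ_three,
    Matrix.of_apply, Matrix.one_apply, hsymm x 1 0, hsymm x 2 0, hsymm x 2 1]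
  simp
  field_simp
  ring

lemma frame_completeness {a t₁ t₂ : Fin 3 → ℝ} (ha : dot3 a a = 1)
    (ht₁ : dot3 t₁ t₁ = 1) (ht₂ : dot3 t₂ t₂ = 1) (ht₁₂ : dot3 t₁ t₂ = 0)
    (hat₁ : dot3 a t₁ = 0) (hat₂ : dot3 a t₂ = 0) (i j : Fin 3) :
    t₁ i * t₁ j + t₂ i * t₂ j = (1 : Matrix (Fin 3) (Fin 3) ℝ) i j - a i * a j := by
  set O : Matrix (Fin 3) (Fin 3) ℝ := Matrix.of ![a, t₁, t₂] with hO
  have h1 : O * Oᵀ = 1 := by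
    simp only [dot3, Fin.sum_univ_three] at *
    ext k l
    fin_cases k <;> fin_cases l <;> simp [hO, mul_apply, Fin.sum_univ_three] <;> linarith
  rw [← mul_eq_one_comm.1 h1]
  simp [hO, mul_apply, Fin.sum_univ_three]
  ring

lemma fderiv_apply_eq_sum (f : (Fin 3 → ℝ) → ℝ) (t : Fin 3 → ℝ) :
    fderiv ℝ f x t = ∑ k, t k * fderiv ℝ f x (Pi.single k 1) := by
  conv_lhs => rw [pi_eq_sum_univ' t]
  simp [map_sum]

lemma fderiv_weighted_Xcomp (he : ∀ i j, Differentiable ℝ fun x => e x i j) (hx : 0 < x 2)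
    (t : Fin 3 → ℝ) :
    fderiv ℝ (fun y => ((y 2) ^ 2)⁻¹ * (1 / y 2) * Xcomp e a t y) x t
      = ∑ k, ∑ i, ∑ j, a i * (t k * t j) * fderiv ℝ (fun y => e y i j) x (Pi.single k 1) := by
  have hev : (fun y => ((y 2) ^ 2)⁻¹ * (1 / y 2) * Xcomp e a t y)
      =ᶠ[𝓝 x] fun y => ∑ i, ∑ j, a i * e y i j * t j := by
    have : ∀ᶠ y : Fin 3 → ℝ in 𝓝 x, y 2 ≠ 0 :=
      (continuous_apply (2 : Fin 3)).continuousAt.eventually_ne hx.ne'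
    filter_upwards [this] with y hy
    rw [Xcomp]
    field_simp
  rw [hev.fderiv_eq, fderiv_apply_eq_sum]
  refine Finset.sum_congr rfl fun k _ => ?_
  have h2 := HasFDerivAt.fun_sum (u := Finset.univ) fun i _ =>
    HasFDerivAt.fun_sum (u := Finset.univ) fun j _ =>
      (((he i j x).hasFDerivAt.const_mul (a i)).mul_const (t j))
  rw [h2.fderiv]
  simp [Fin.sum_univ_three]
  ring

lemma divFVX_eq (he : ∀ i j, Differentiable ℝ fun x => e x i j) (hx : 0 < x 2)
    (hsymm : ∀ x i j, e x i j = e x j i) {t₁ t₂ : Fin 3 → ℝ} (ha : dot3 a a = 1)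
    (ht₁ : dot3 t₁ t₁ = 1) (ht₂ : dot3 t₂ t₂ = 1) (ht₁₂ : dot3 t₁ t₂ = 0)
    (hat₁ : dot3 a t₁ = 0) (hat₂ : dot3 a t₂ = 0) :
    divFVX e a t₁ t₂ x = 1 / x 2 * (∑ k, ∑ i, ∑ j, ((1 : Matrix (Fin 3) (Fin 3) ℝ) k i * a j
        - a k * a i * a j) * frameDE e x k i j
      - 2 * (frameE e x *ᵥ a) 2 + 2 * a 2 * (a ⬝ᵥ frameE e x *ᵥ a)) := by
  have hframe := frame_completeness ha ht₁ ht₂ ht₁₂ hat₁ hat₂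
  have hfs : ∀ i j, (fun y => e y i j) = fun y => e y j i := fun i j => funext fun y => hsymm y i j
  rw [divFVX, fderiv_weighted_Xcomp he hx, fderiv_weighted_Xcomp he hx]
  simp only [← Finset.sum_add_distrib, ← add_mul, ← mul_add, hframe]
  have hx' := hx.ne'
  simp only [frameDE, frameE, mulVec, dotProduct, Fin.sum_univ_three,
    Matrix.of_apply, Matrix.one_apply, hsymm x 1 0, hsymm x 2 0, hsymm x 2 1,
    hfs 1 0, hfs 2 0, hfs 2 1]
  simp
  field_simp
  ring

/-- After multiplication by `x³`, the error term is twice the nonlinear part of the mean curvature: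
all terms linear in `e` cancel. -/
lemma error_eq (he : ∀ i j, Differentiable ℝ fun x => e x i j) (hx : 0 < x 2)
    (hG : (gMatrix e x).PosDef)
    (hsymm : ∀ x i j, e x i j = e x j i) {t₁ t₂ : Fin 3 → ℝ} (ha : dot3 a a = 1)
    (ht₁ : dot3 t₁ t₁ = 1) (ht₂ : dot3 t₂ t₂ = 1) (ht₁₂ : dot3 t₁ t₂ = 0)
    (hat₁ : dot3 a t₁ = 0) (hat₂ : dot3 a t₂ = 0) :
    UNu e a x - (2 * (1 / x 2) * (meanCurv gbarMatrix a x - meanCurv (gMatrix e) a x)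
        - divFVX e a t₁ t₂ x)
      = 1 / x 2 * (-4 * (frameS e a x * frameW e a x 2 - a 2
          - 1 / 2 * (a ⬝ᵥ frameE e x *ᵥ a) * a 2 + (frameE e x *ᵥ a) 2)
        + 2 * ∑ k, ∑ i, ∑ j,
          (curvCoeff e a x k i j - flatCurvCoeff a k i j) * frameDE e x k i j) := by
  have ha0 : a ≠ 0 := by
    rintro rfl
    simp [dot3] at ha
  rw [meanCurv_gbarMatrix hx ha, meanCurv_gMatrix he hx hG ha0, UNu_eq he hx hsymm,
    divFVX_eq he hx hsymm ha ht₁ ht₂ ht₁₂ hat₁ hat₂]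
  have hsum : ∑ k, ∑ i, ∑ j, ((1 : Matrix (Fin 3) (Fin 3) ℝ) k i * a j
        - a k * (1 : Matrix (Fin 3) (Fin 3) ℝ) j i) * frameDE e x k i j
      + ∑ k, ∑ i, ∑ j, ((1 : Matrix (Fin 3) (Fin 3) ℝ) k i * a j
        - a k * a i * a j) * frameDE e x k i j
      = -2 * ∑ k, ∑ i, ∑ j, flatCurvCoeff a k i j * frameDE e x k i j := by
    simp only [Finset.mul_sum, ← Finset.sum_add_distrib, flatCurvCoeff]
    refine Finset.sum_congr rfl fun k _ => Finset.sum_congr rfl fun i _ =>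
      Finset.sum_congr rfl fun j _ => ?_
    ring
  simp only [sub_mul (curvCoeff _ _ _ _ _ _), Finset.sum_sub_distrib]
  linear_combination (1 / x 2) * hsum

end Identities

section Asymptotics

open Asymptotics

lemma isBigO_mul_sub_mul {α : Type*} {l : Filter α} {ε f g : α → ℝ} {c d : ℝ}
    (hε : ε =O[l] fun _ => (1:ℝ)) (hf : (fun x => f x - c) =O[l] ε)
    (hg : (fun x => g x - d) =O[l] ε) : (fun x => f x * g x - c * d) =O[l] ε := by
  have h1 : (fun x => (f x - c) * (g x - d)) =O[l] ε := by
    simpa using hf.mul (hg.trans hε)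
  refine ((h1.add (hg.const_mul_left c)).add (hf.const_mul_left d)).congr_left fun x => ?_
  ring

lemma sq_inv_mulVec_le {M : Matrix (Fin 3) (Fin 3) ℝ} (hM : M.PosDef) {c : ℝ} (hc : 0 < c)
    (hco : ∀ v, c * (v ⬝ᵥ v) ≤ v ⬝ᵥ M *ᵥ v) (v : Fin 3 → ℝ) (i : Fin 3) :
    (M⁻¹ *ᵥ v) i ^ 2 ≤ (v ⬝ᵥ v) / c ^ 2 := by
  have h := hco (M⁻¹ *ᵥ v)
  rw [mulVec_mulVec, mul_nonsing_inv _ hM.det_pos.ne'.isUnit, one_mulVec] at h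
  set w := M⁻¹ *ᵥ v
  rw [le_div_iff₀ (by positivity)]
  have h2 : c ^ 2 * (w ⬝ᵥ w) ≤ v ⬝ᵥ v := by
    have h3 : 0 ≤ (v - c • w) ⬝ᵥ (v - c • w) :=
      Finset.sum_nonneg fun i _ => mul_self_nonneg _
    simp only [sub_dotProduct, dotProduct_sub, smul_dotProduct, dotProduct_smul, smul_eq_mul,
      dotProduct_comm v w] at h3
    nlinarith
  have h4 : w i ^ 2 ≤ w ⬝ᵥ w := by
    rw [dotProduct, sq]
    exact Finset.single_le_sum (f := fun i => w i * w i) (fun j _ => mul_self_nonneg (w j))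
      (Finset.mem_univ i)
  nlinarith [sq_nonneg c]

variable {e : (Fin 3 → ℝ) → Matrix (Fin 3) (Fin 3) ℝ} {a : Fin 3 → ℝ}
  {l : Filter (Fin 3 → ℝ)} {ε : (Fin 3 → ℝ) → ℝ} {c : ℝ}

lemma frameG_inv_isBigO_one (hG : ∀ᶠ x in l, (frameG e x).PosDef) (hc : 0 < c)
    (hco : ∀ᶠ x in l, ∀ v, c * (v ⬝ᵥ v) ≤ v ⬝ᵥ frameG e x *ᵥ v) (i j : Fin 3) :
    (fun x => (frameG e x)⁻¹ i j) =O[l] fun _ => (1:ℝ) := by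
  refine IsBigO.of_bound (1 / c) ?_
  filter_upwards [hG, hco] with x hx hcx
  have h := sq_inv_mulVec_le hx hc hcx (Pi.single j 1) i
  rw [mulVec_single_one] at h
  rw [norm_one, mul_one, Real.norm_eq_abs]
  refine abs_le_of_sq_le_sq ?_ (by positivity)
  simpa [div_pow] using h

lemma frameG_inv_sub_one_isBigO (hG : ∀ᶠ x in l, (frameG e x).PosDef)
    (hE : ∀ i j, (fun x => frameE e x i j) =O[l] ε) (hc : 0 < c)
    (hco : ∀ᶠ x in l, ∀ v, c * (v ⬝ᵥ v) ≤ v ⬝ᵥ frameG e x *ᵥ v) (i j : Fin 3) :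
    (fun x => (frameG e x)⁻¹ i j - (1 : Matrix (Fin 3) (Fin 3) ℝ) i j) =O[l] ε := by
  have h1 : (fun x => -∑ k, frameE e x i k * (frameG e x)⁻¹ k j) =O[l] ε := by
    refine (IsBigO.fun_sum fun k _ => ?_).neg_left
    simpa using (hE i k).mul (frameG_inv_isBigO_one hG hc hco k j)
  refine h1.congr' ?_ .rfl
  filter_upwards [hG] with x hx
  have h : frameG e x * (frameG e x)⁻¹ = 1 := mul_nonsing_inv _ hx.det_pos.ne'.isUnit
  nth_rw 1 [frameG, add_mul, one_mul] at h
  rw [← mul_apply, ← h]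
  simp

lemma frameW_sub_isBigO (hG : ∀ᶠ x in l, (frameG e x).PosDef)
    (hE : ∀ i j, (fun x => frameE e x i j) =O[l] ε) (hc : 0 < c)
    (hco : ∀ᶠ x in l, ∀ v, c * (v ⬝ᵥ v) ≤ v ⬝ᵥ frameG e x *ᵥ v) (i : Fin 3) :
    (fun x => frameW e a x i - a i) =O[l] ε := by
  have h1 : (fun x => ∑ j, a j * ((frameG e x)⁻¹ i j - (1 : Matrix (Fin 3) (Fin 3) ℝ) i j))
      =O[l] ε :=
    IsBigO.fun_sum fun j _ => (frameG_inv_sub_one_isBigO hG hE hc hco i j).const_mul_left (a j)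
  refine h1.congr_left fun x => ?_
  simp [mul_sub, frameW, mulVec, dotProduct, mul_comm, Matrix.one_apply]

lemma frameG_mulVec_frameW {x : Fin 3 → ℝ} (hx : (frameG e x).PosDef) :
    frameW e a x + frameE e x *ᵥ frameW e a x = a := by
  have h : frameG e x *ᵥ frameW e a x = a := by
    rw [frameW, mulVec_mulVec, mul_nonsing_inv _ hx.det_pos.ne'.isUnit, one_mulVec]
  rwa [frameG, add_mulVec, one_mulVec] at h

lemma frameW_second_order (hG : ∀ᶠ x in l, (frameG e x).PosDef)
    (hE : ∀ i j, (fun x => frameE e x i j) =O[l] ε) (hc : 0 < c)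
    (hco : ∀ᶠ x in l, ∀ v, c * (v ⬝ᵥ v) ≤ v ⬝ᵥ frameG e x *ᵥ v) (i : Fin 3) :
    (fun x => frameW e a x i - a i + (frameE e x *ᵥ a) i) =O[l] fun x => ε x * ε x := by
  have h1 : (fun x => -∑ j, frameE e x i j * (frameW e a x j - a j))
      =O[l] fun x => ε x * ε x :=
    (IsBigO.fun_sum fun j _ => (hE i j).mul (frameW_sub_isBigO hG hE hc hco j)).neg_left
  refine h1.congr' ?_ .rfl
  filter_upwards [hG] with x hx
  have h := congrFun (frameG_mulVec_frameW (a := a) hx) i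
  simp only [Pi.add_apply] at h
  simp only [mul_sub, Finset.sum_sub_distrib]
  simp only [mulVec, dotProduct] at h ⊢
  linarith

lemma dotProduct_frameW_second_order (ha : a ⬝ᵥ a = 1) (hG : ∀ᶠ x in l, (frameG e x).PosDef)
    (hE : ∀ i j, (fun x => frameE e x i j) =O[l] ε) (hc : 0 < c)
    (hco : ∀ᶠ x in l, ∀ v, c * (v ⬝ᵥ v) ≤ v ⬝ᵥ frameG e x *ᵥ v) :
    (fun x => a ⬝ᵥ frameW e a x - 1 + a ⬝ᵥ frameE e x *ᵥ a) =O[l] fun x => ε x * ε x := by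
  have h1 : (fun x => ∑ i, a i * (frameW e a x i - a i + (frameE e x *ᵥ a) i))
      =O[l] fun x => ε x * ε x :=
    IsBigO.fun_sum fun i _ => (frameW_second_order hG hE hc hco i).const_mul_left (a i)
  refine h1.congr_left fun x => ?_
  rw [← ha]
  simp only [mul_add, mul_sub, Finset.sum_add_distrib, Finset.sum_sub_distrib]
  rfl

lemma dotProduct_frameW_sub_one (ha : a ⬝ᵥ a = 1) (hG : ∀ᶠ x in l, (frameG e x).PosDef)
    (hE : ∀ i j, (fun x => frameE e x i j) =O[l] ε) (hc : 0 < c)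
    (hco : ∀ᶠ x in l, ∀ v, c * (v ⬝ᵥ v) ≤ v ⬝ᵥ frameG e x *ᵥ v) :
    (fun x => a ⬝ᵥ frameW e a x - 1) =O[l] ε := by
  have h1 : (fun x => ∑ i, a i * (frameW e a x i - a i)) =O[l] ε :=
    IsBigO.fun_sum fun i _ => (frameW_sub_isBigO hG hE hc hco i).const_mul_left (a i)
  refine h1.congr_left fun x => ?_
  rw [← ha]
  simp only [mul_sub, Finset.sum_sub_distrib]
  rfl

lemma frameS_isBigO_one (ha : a ⬝ᵥ a = 1) (hG : ∀ᶠ x in l, (frameG e x).PosDef)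
    (hε : ε =O[l] fun _ => (1:ℝ))
    (hE : ∀ i j, (fun x => frameE e x i j) =O[l] ε) (hc : 0 < c)
    (hco : ∀ᶠ x in l, ∀ v, c * (v ⬝ᵥ v) ≤ v ⬝ᵥ frameG e x *ᵥ v) :
    frameS e a =O[l] fun _ => (1:ℝ) := by
  have ha0 : a ≠ 0 := by
    rintro rfl
    simp at ha
  have hW : ∀ j, (fun x => frameW e a x j) =O[l] fun x => √(a ⬝ᵥ frameW e a x) := by
    intro j
    refine IsBigO.of_bound (√(1 / c)) ?_
    filter_upwards [hG, hco] with x hx hcx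
    rw [Real.norm_of_nonneg (Real.sqrt_nonneg _), ← Real.sqrt_mul (by positivity),
      Real.norm_eq_abs]
    refine Real.abs_le_sqrt ?_
    have h := hcx (frameW e a x)
    rw [frameG, add_mulVec, one_mulVec, frameG_mulVec_frameW hx, dotProduct_comm _ a] at h
    have h4 : frameW e a x j ^ 2 ≤ frameW e a x ⬝ᵥ frameW e a x := by
      rw [dotProduct, sq]
      exact Finset.single_le_sum (f := fun i => frameW e a x i * frameW e a x i)
        (fun j _ => mul_self_nonneg _) (Finset.mem_univ j)
    rw [one_div, ← div_eq_inv_mul, le_div_iff₀ hc]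
    nlinarith
  have hone : (fun _ => (1:ℝ)) =O[l] fun x => √(a ⬝ᵥ frameW e a x) := by
    have h1 : (fun x => ∑ i, a i * (frameW e a x i + ∑ j, frameE e x i j * frameW e a x j))
        =O[l] fun x => √(a ⬝ᵥ frameW e a x) := by
      refine IsBigO.fun_sum fun i _ => IsBigO.const_mul_left ((hW i).add
        (IsBigO.fun_sum fun j _ => ?_)) _
      simpa using ((hE i j).trans hε).mul (hW j)
    refine h1.congr' ?_ .rfl
    filter_upwards [hG] with x hx
    have h := frameG_mulVec_frameW (a := a) hx
    rw [← ha]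
    nth_rw 4 [← h]
    rw [dotProduct_comm]
    rfl
  have h := (isBigO_refl (frameS e a) l).mul hone
  simp only [mul_one] at h
  refine h.congr' .rfl ?_
  filter_upwards [hG] with x hx
  rw [frameS, inv_mul_cancel₀ (Real.sqrt_pos.2 (dotProduct_frameW_pos hx ha0)).ne']

lemma sqrt_dotProduct_frameW_sub_one (ha : a ⬝ᵥ a = 1) (hG : ∀ᶠ x in l, (frameG e x).PosDef)
    (hE : ∀ i j, (fun x => frameE e x i j) =O[l] ε) (hc : 0 < c)
    (hco : ∀ᶠ x in l, ∀ v, c * (v ⬝ᵥ v) ≤ v ⬝ᵥ frameG e x *ᵥ v) :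
    (fun x => √(a ⬝ᵥ frameW e a x) - 1) =O[l] ε := by
  have ha0 : a ≠ 0 := by
    rintro rfl
    simp at ha
  refine IsBigO.trans (IsBigO.of_bound 1 ?_) (dotProduct_frameW_sub_one ha hG hE hc hco)
  filter_upwards [hG] with x hx
  have h1 := Real.sq_sqrt (dotProduct_frameW_pos hx ha0).le
  set u := √(a ⬝ᵥ frameW e a x)
  have hu : 0 ≤ u := Real.sqrt_nonneg _
  have h2 : a ⬝ᵥ frameW e a x - 1 = (u - 1) * (u + 1) := by rw [← h1]; ring
  rw [h2, norm_mul, one_mul, Real.norm_of_nonneg (by linarith : 0 ≤ u + 1)]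
  nlinarith [norm_nonneg (u - 1)]

lemma frameS_sub_one (ha : a ⬝ᵥ a = 1) (hG : ∀ᶠ x in l, (frameG e x).PosDef)
    (hε : ε =O[l] fun _ => (1:ℝ))
    (hE : ∀ i j, (fun x => frameE e x i j) =O[l] ε) (hc : 0 < c)
    (hco : ∀ᶠ x in l, ∀ v, c * (v ⬝ᵥ v) ≤ v ⬝ᵥ frameG e x *ᵥ v) :
    (fun x => frameS e a x - 1) =O[l] ε := by
  have ha0 : a ≠ 0 := by
    rintro rfl
    simp at ha
  have h := ((sqrt_dotProduct_frameW_sub_one ha hG hE hc hco).mul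
    (frameS_isBigO_one ha hG hε hE hc hco)).neg_left
  simp only [mul_one] at h
  refine h.congr' ?_ .rfl
  filter_upwards [hG] with x hx
  have := (Real.sqrt_pos.2 (dotProduct_frameW_pos hx ha0)).ne'
  rw [frameS]
  field_simp
  ring

lemma frameS_second_order (ha : a ⬝ᵥ a = 1) (hG : ∀ᶠ x in l, (frameG e x).PosDef)
    (hε : ε =O[l] fun _ => (1:ℝ))
    (hE : ∀ i j, (fun x => frameE e x i j) =O[l] ε) (hc : 0 < c)
    (hco : ∀ᶠ x in l, ∀ v, c * (v ⬝ᵥ v) ≤ v ⬝ᵥ frameG e x *ᵥ v) :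
    (fun x => frameS e a x - 1 - 1 / 2 * (a ⬝ᵥ frameE e x *ᵥ a)) =O[l] fun x => ε x * ε x := by
  have ha0 : a ≠ 0 := by
    rintro rfl
    simp at ha
  have hu := sqrt_dotProduct_frameW_sub_one ha hG hE hc hco
  have h1 : (fun x => (√(a ⬝ᵥ frameW e a x) - 1) * (√(a ⬝ᵥ frameW e a x) - 1) *
      (1 / 2 + frameS e a x)) =O[l] fun x => ε x * ε x := by
    have := (hu.mul hu).mul ((isBigO_const_const (1 / 2 : ℝ) one_ne_zero l).add
      (frameS_isBigO_one ha hG hε hE hc hco))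
    simpa using this
  refine (h1.sub ((dotProduct_frameW_second_order ha hG hE hc hco).const_mul_left
    (1 / 2))).congr' ?_ .rfl
  filter_upwards [hG] with x hx
  have hQ := dotProduct_frameW_pos hx ha0
  have hne := (Real.sqrt_pos.2 hQ).ne'
  have h2 := Real.sq_sqrt hQ.le
  rw [frameS]
  generalize a ⬝ᵥ frameE e x *ᵥ a = q at *
  rw [← h2]
  simp only [Real.sqrt_sq (Real.sqrt_nonneg _)]
  field_simp
  ring

lemma curvCoeff_sub_flatCurvCoeff (ha : a ⬝ᵥ a = 1) (hG : ∀ᶠ x in l, (frameG e x).PosDef)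
    (hε : ε =O[l] fun _ => (1:ℝ))
    (hE : ∀ i j, (fun x => frameE e x i j) =O[l] ε) (hc : 0 < c)
    (hco : ∀ᶠ x in l, ∀ v, c * (v ⬝ᵥ v) ≤ v ⬝ᵥ frameG e x *ᵥ v) (k i j : Fin 3) :
    (fun x => curvCoeff e a x k i j - flatCurvCoeff a k i j) =O[l] ε := by
  have hS := frameS_sub_one ha hG hε hE hc hco
  have hW := frameW_sub_isBigO (a := a) hG hE hc hco
  have hP := frameG_inv_sub_one_isBigO hG hE hc hco
  have mul := fun {f g : (Fin 3 → ℝ) → ℝ} {c d : ℝ} => isBigO_mul_sub_mul (f := f) (g := g)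
    (c := c) (d := d) hε
  have h1 := mul (mul hS (hP k i)) (hW j)
  have h2 := mul (mul (mul (mul hS (mul hS hS)) (hW k)) (hW i)) (hW j)
  have h3 := mul (mul hS (hW k)) (hP j i)
  refine ((h1.neg_left.add (h2.const_mul_left (1 / 2))).add
    (h3.const_mul_left (1 / 2))).congr_left fun x => ?_
  rw [curvCoeff, flatCurvCoeff]
  ring

lemma normal_second_order (ha : a ⬝ᵥ a = 1) (hG : ∀ᶠ x in l, (frameG e x).PosDef)
    (hε : ε =O[l] fun _ => (1:ℝ))
    (hE : ∀ i j, (fun x => frameE e x i j) =O[l] ε) (hc : 0 < c)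
    (hco : ∀ᶠ x in l, ∀ v, c * (v ⬝ᵥ v) ≤ v ⬝ᵥ frameG e x *ᵥ v) (i : Fin 3) :
    (fun x => frameS e a x * frameW e a x i - a i
      - 1 / 2 * (a ⬝ᵥ frameE e x *ᵥ a) * a i + (frameE e x *ᵥ a) i)
      =O[l] fun x => ε x * ε x := by
  have hS := frameS_second_order ha hG hε hE hc hco
  have h1 := (frameS_sub_one ha hG hε hE hc hco).mul (frameW_sub_isBigO (a := a) hG hE hc hco i)
  refine ((h1.add (hS.const_mul_left (a i))).add
    (frameW_second_order (a := a) hG hE hc hco i)).congr_left fun x => ?_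
  ring

end Asymptotics

section Bounds

variable {e : (Fin 3 → ℝ) → Matrix (Fin 3) (Fin 3) ℝ}

lemma abs_frameE_le_normE (x : Fin 3 → ℝ) (i j : Fin 3) : |frameE e x i j| ≤ normE e x := by
  refine Real.abs_le_sqrt ?_
  refine le_trans ?_ (Finset.single_le_sum (f := fun i => ∑ j, ((x 2) ^ 2 * e x i j) ^ 2)
    (fun i _ => Finset.sum_nonneg fun j _ => sq_nonneg _) (Finset.mem_univ i))
  exact Finset.single_le_sum (f := fun j => ((x 2) ^ 2 * e x i j) ^ 2)
    (fun j _ => sq_nonneg _) (Finset.mem_univ j)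

lemma abs_cov1_le_normDE (x : Fin 3 → ℝ) (k i j : Fin 3) :
    |(x 2) ^ 3 * cov1 e x k i j| ≤ normDE e x := by
  refine Real.abs_le_sqrt ?_
  refine le_trans ?_ (Finset.single_le_sum
    (f := fun k => ∑ i, ∑ j, ((x 2) ^ 3 * cov1 e x k i j) ^ 2)
    (fun k _ => Finset.sum_nonneg fun i _ => Finset.sum_nonneg fun j _ => sq_nonneg _)
    (Finset.mem_univ k))
  refine le_trans ?_ (Finset.single_le_sum
    (f := fun i => ∑ j, ((x 2) ^ 3 * cov1 e x k i j) ^ 2)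
    (fun i _ => Finset.sum_nonneg fun j _ => sq_nonneg _) (Finset.mem_univ i))
  exact Finset.single_le_sum (f := fun j => ((x 2) ^ 3 * cov1 e x k i j) ^ 2)
    (fun j _ => sq_nonneg _) (Finset.mem_univ j)

/-- The constants `x³ Γᵏᵢⱼ`. -/
def scaledChristoffel (i j k : Fin 3) : ℝ :=
  -((if i = 2 then (1:ℝ) else 0) * (if j = k then 1 else 0)
    + (if j = 2 then (1:ℝ) else 0) * (if i = k then 1 else 0)
    - (if i = j then (1:ℝ) else 0) * (if k = 2 then 1 else 0))

lemma frameDE_eq {x : Fin 3 → ℝ} (hx : 0 < x 2) (k i j : Fin 3) :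
    frameDE e x k i j = (x 2) ^ 3 * cov1 e x k i j
      + ∑ l, scaledChristoffel k i l * frameE e x l j
      + ∑ l, scaledChristoffel k j l * frameE e x i l
      + 2 * (if k = 2 then 1 else 0) * frameE e x i j := by
  have hx' := hx.ne'
  have hΓ : ∀ i j k, x 2 * ΓH x i j k = scaledChristoffel i j k := fun i j k => by
    rw [ΓH, scaledChristoffel]
    field_simp
  simp only [frameDE, frameE, cov1, Matrix.of_apply, ← hΓ, mul_sub, Finset.mul_sum]
  have h1 : ∀ l, x 2 * ΓH x k i l * (x 2 ^ 2 * e x l j) = x 2 ^ 3 * (ΓH x k i l * e x l j) :=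
    fun l => by ring
  have h2 : ∀ l, x 2 * ΓH x k j l * (x 2 ^ 2 * e x i l) = x 2 ^ 3 * (ΓH x k j l * e x i l) :=
    fun l => by ring
  simp only [h1, h2]
  ring

lemma isCompact_hyperbolic_ball (R : ℝ) :
    IsCompact {x : Fin 3 → ℝ | dot3 x x + 1 ≤ 2 * x 2 * R} := by
  refine (isCompact_closedBall (0 : Fin 3 → ℝ) (2 * |R|)).of_isClosed_subset ?_ ?_
  · refine isClosed_le ?_ (by fun_prop)
    simp only [dot3]
    fun_prop
  · intro x hx
    simp only [Set.mem_ofPred_eq, dot3, Fin.sum_univ_three] at hx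
    rw [mem_closedBall_zero_iff, pi_norm_le_iff_of_nonneg (by positivity)]
    have hR := le_abs_self R
    have hpos : 0 < x 2 * R := by nlinarith [sq_nonneg (x 0), sq_nonneg (x 1), sq_nonneg (x 2)]
    have habs : x 2 * R ≤ |x 2| * |R| := by rw [← abs_mul]; exact le_abs_self _
    have h2 : |x 2| ≤ 2 * |R| := by
      by_contra! h
      nlinarith [abs_nonneg (x 2), abs_nonneg R, sq_abs (x 2), sq_nonneg (x 0), sq_nonneg (x 1)]
    have hb : x 2 * R ≤ 2 * |R| * |R| := by nlinarith [abs_nonneg R]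
    intro i
    refine abs_le_of_sq_le_sq ?_ (by positivity)
    fin_cases i <;> simp <;> nlinarith [sq_nonneg (x 0), sq_nonneg (x 1), sq_nonneg (x 2)]

lemma half_le_of_small {H : Matrix (Fin 3) (Fin 3) ℝ} (hH : ∀ i j, |H i j| ≤ 1 / 6)
    (v : Fin 3 → ℝ) : 1 / 2 * (v ⬝ᵥ v) ≤ v ⬝ᵥ (1 + H) *ᵥ v := by
  have h : ∀ i j, -(1 / 12 * (v i ^ 2 + v j ^ 2)) ≤ v i * (H i j * v j) := by
    intro i j
    have h1 := abs_le.1 (hH i j)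
    nlinarith [sq_nonneg (v i + v j), sq_nonneg (v i - v j),
      mul_nonneg (sub_nonneg.2 h1.2) (sq_nonneg (v i - v j)),
      mul_nonneg (sub_nonneg.2 h1.2) (sq_nonneg (v i + v j)),
      mul_nonneg (sub_nonneg.2 h1.1) (sq_nonneg (v i + v j)),
      mul_nonneg (sub_nonneg.2 h1.1) (sq_nonneg (v i - v j))]
  have hs := Finset.sum_le_sum fun i (_ : i ∈ Finset.univ) =>
    Finset.sum_le_sum fun j (_ : j ∈ Finset.univ) => h i j
  rw [add_mulVec, one_mulVec, dotProduct_add]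
  simp only [dotProduct, mulVec, Fin.sum_univ_three] at hs ⊢
  nlinarith

lemma exists_coercive (hcont : ∀ i j, Continuous fun x => e x i j)
    (hpos : ∀ x : Fin 3 → ℝ, 0 < x 2 → (gMatrix e x).PosDef) {τ C₀ : ℝ} (hτ : 0 < τ)
    (hE : ∀ x : Fin 3 → ℝ, 0 < x 2 → ∀ i j, |frameE e x i j| ≤ C₀ * Real.exp (-τ * hDist o3 x)) :
    ∃ c > 0, ∀ x : Fin 3 → ℝ, 0 < x 2 → ∀ v, c * (v ⬝ᵥ v) ≤ v ⬝ᵥ frameG e x *ᵥ v := by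
  set R := Real.exp (Real.log (6 * C₀) / τ) with hR
  have hRpos : 0 < R := Real.exp_pos _
  set K := {x : Fin 3 → ℝ | dot3 x x + 1 ≤ 2 * x 2 * R} ×ˢ {v : Fin 3 → ℝ | dot3 v v = 1}
  have hS : IsCompact {v : Fin 3 → ℝ | dot3 v v = 1} := by
    refine (isCompact_closedBall (0 : Fin 3 → ℝ) 1).of_isClosed_subset ?_ ?_
    · refine isClosed_eq ?_ continuous_const
      simp only [dot3]
      fun_prop
    · intro v hv
      simp only [Set.mem_ofPred_eq, dot3, Fin.sum_univ_three] at hv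
      rw [mem_closedBall_zero_iff, pi_norm_le_iff_of_nonneg zero_le_one]
      intro i
      refine abs_le_of_sq_le_sq ?_ zero_le_one
      fin_cases i <;> dsimp only [Fin.zero_eta, Fin.mk_one, Fin.reduceFinMk] <;>
        nlinarith [sq_nonneg (v 0), sq_nonneg (v 1), sq_nonneg (v 2)]
  have hf : Continuous fun p : (Fin 3 → ℝ) × (Fin 3 → ℝ) => p.2 ⬝ᵥ frameG e p.1 *ᵥ p.2 := by
    have h : ∀ i j, Continuous fun p : (Fin 3 → ℝ) × (Fin 3 → ℝ) => e p.1 i j := fun i j =>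
      (hcont i j).comp continuous_fst
    simp only [dotProduct, mulVec, frameG, frameE, Matrix.add_apply, Matrix.of_apply]
    fun_prop
  obtain ⟨c, hc, hcK⟩ := ((isCompact_hyperbolic_ball R).prod hS).exists_forall_le'
    hf.continuousOn (a := 0) (by
      rintro ⟨x, v⟩ ⟨hx, hv⟩
      simp only [Set.mem_ofPred_eq] at hx hv
      have hx2 : 0 < x 2 := by nlinarith [dot3_self_nonneg x]
      have hv0 : v ≠ 0 := by
        rintro rfl
        simp [dot3] at hv
      simpa using (posDef_frameG hx2 (hpos x hx2)).dotProduct_mulVec_pos hv0)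
  refine ⟨min c (1 / 2), lt_min hc (by norm_num), fun x hx v => ?_⟩
  have hvv : 0 ≤ v ⬝ᵥ v := dot3_self_nonneg v
  by_cases hsmall : ∀ i j, |frameE e x i j| ≤ 1 / 6
  · exact (mul_le_mul_of_nonneg_right (min_le_right _ _) hvv).trans (half_le_of_small hsmall v)
  push Not at hsmall
  obtain ⟨i, j, hij⟩ := hsmall
  have h1 := hij.trans_le (hE x hx i j)
  have hC : 0 < C₀ := by
    by_contra! h
    nlinarith [Real.exp_pos (-τ * hDist o3 x)]
  have hxK : dot3 x x + 1 ≤ 2 * x 2 * R := by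
    refine (dot3_add_one_le x hx).trans ?_
    gcongr
    rw [hR, Real.exp_le_exp, le_div_iff₀ hτ, Real.le_log_iff_exp_le (by positivity)]
    rw [neg_mul, Real.exp_neg, ← div_eq_mul_inv, lt_div_iff₀ (Real.exp_pos _)] at h1
    rw [mul_comm]
    linarith
  refine (mul_le_mul_of_nonneg_right (min_le_left _ _) hvv).trans ?_
  rcases eq_or_lt_of_le hvv with h0 | h0
  · have : v = 0 := by simpa using h0.symm
    simp [this]
  · have hn := hcK (x, (√(v ⬝ᵥ v))⁻¹ • v) ⟨hxK, by
      simp only [Set.mem_ofPred_eq]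
      change ((√(v ⬝ᵥ v))⁻¹ • v) ⬝ᵥ ((√(v ⬝ᵥ v))⁻¹ • v) = 1
      rw [smul_dotProduct, dotProduct_smul, smul_eq_mul, smul_eq_mul, ← mul_assoc, ← mul_inv,
        Real.mul_self_sqrt hvv, inv_mul_cancel₀ h0.ne']⟩
    simp only [smul_dotProduct, mulVec_smul, dotProduct_smul, smul_eq_mul] at hn
    rw [← mul_assoc, ← mul_inv, Real.mul_self_sqrt hvv, ← div_eq_inv_mul, le_div_iff₀ h0] at hn
    exact hn

end Bounds

/-- Mean curvature expansion on a planar face (eq. (2.5) of Jang–Miao with the exact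
cancellation of the lower-order terms): if `g = ḡ + e` is asymptotically hyperbolic
with `|e|_ḡ + |∇̄e|_ḡ + |∇̄∇̄e|_ḡ = O(e^{-τ r})`, `τ > 3/2`, then along the face
`F ⊂ {⟨a,x⟩ = d}` (with `ν̄ = x³ a`, `∂_ν̄ V = -a³ V`, `Ā = -a³ ḡ|_F`):
`𝕌(ν̄) = 2V(H̄ - H) - div_F(V X) + O(e^{(-2τ+1) r})`. -/
theorem mean_curvature_expansion (τ : ℝ) (hτ : 3 / 2 < τ)
    (e : (Fin 3 → ℝ) → Matrix (Fin 3) (Fin 3) ℝ)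
    (hsmooth : ∀ i j, ContDiff ℝ 2 (fun x => e x i j)) (hsymm : ∀ x i j, e x i j = e x j i)
    (hpos : ∀ x : Fin 3 → ℝ, 0 < x 2 → (gMatrix e x).PosDef)
    (C₀ : ℝ) (hdecay : ∀ x : Fin 3 → ℝ, 0 < x 2 →
      normE e x + normDE e x + normDDE e x ≤ C₀ * Real.exp (-τ * hDist o3 x))
    (a t₁ t₂ : Fin 3 → ℝ) (ha : dot3 a a = 1)
    (ht₁ : dot3 t₁ t₁ = 1) (ht₂ : dot3 t₂ t₂ = 1) (ht₁₂ : dot3 t₁ t₂ = 0)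
    (hat₁ : dot3 a t₁ = 0) (hat₂ : dot3 a t₂ = 0) (d : ℝ) :
    ∃ C > 0, ∀ x : Fin 3 → ℝ, 0 < x 2 → dot3 a x = d →
      |UNu e a x
          - (2 * (1 / x 2) * (meanCurv gbarMatrix a x - meanCurv (gMatrix e) a x)
            - divFVX e a t₁ t₂ x)|
        ≤ C * Real.exp ((-2 * τ + 1) * hDist o3 x) := by
  have he : ∀ i j, Differentiable ℝ fun x => e x i j := fun i j =>
    (hsmooth i j).differentiable two_ne_zero
  have ha' : a ⬝ᵥ a = 1 := ha
  have hEb : ∀ x : Fin 3 → ℝ, 0 < x 2 → ∀ i j,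
      |frameE e x i j| ≤ C₀ * Real.exp (-τ * hDist o3 x) := fun x hx i j => by
    have h1 : 0 ≤ normDE e x := Real.sqrt_nonneg _
    have h2 : 0 ≤ normDDE e x := Real.sqrt_nonneg _
    linarith [hdecay x hx, abs_frameE_le_normE (e := e) x i j]
  obtain ⟨c, hc, hco⟩ := exists_coercive (fun i j => (he i j).continuous) hpos (by linarith) hEb
  set l : Filter (Fin 3 → ℝ) := 𝓟 {x | 0 < x 2}
  set ε : (Fin 3 → ℝ) → ℝ := fun x => Real.exp (-τ * hDist o3 x) with hεdef
  have hmem : ∀ᶠ x in l, 0 < x 2 := mem_principal_self _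
  have hG : ∀ᶠ x in l, (frameG e x).PosDef := hmem.mono fun x hx => posDef_frameG hx (hpos x hx)
  have hco' : ∀ᶠ x in l, ∀ v, c * (v ⬝ᵥ v) ≤ v ⬝ᵥ frameG e x *ᵥ v := hmem.mono hco
  have hε : ε =O[l] fun _ => (1:ℝ) := by
    refine Asymptotics.IsBigO.of_bound 1 (hmem.mono fun x hx => ?_)
    rw [norm_one, mul_one, Real.norm_of_nonneg (Real.exp_pos _).le, Real.exp_le_one_iff]
    nlinarith [hDist_nonneg x hx]
  have hE : ∀ i j, (fun x => frameE e x i j) =O[l] ε := fun i j =>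
    Asymptotics.IsBigO.of_bound C₀ (hmem.mono fun x hx => by
      rw [Real.norm_of_nonneg (Real.exp_pos _).le]
      exact hEb x hx i j)
  have hcov : ∀ k i j, (fun x => (x 2) ^ 3 * cov1 e x k i j) =O[l] ε := fun k i j =>
    Asymptotics.IsBigO.of_bound C₀ (hmem.mono fun x hx => by
      rw [Real.norm_of_nonneg (Real.exp_pos _).le]
      have h1 : 0 ≤ normE e x := Real.sqrt_nonneg _
      have h2 : 0 ≤ normDDE e x := Real.sqrt_nonneg _
      have h3 := abs_cov1_le_normDE (e := e) x k i j
      rw [Real.norm_eq_abs]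
      linarith [hdecay x hx])
  have hD : ∀ k i j, (fun x => frameDE e x k i j) =O[l] ε := fun k i j => by
    have h1 : (fun x => ∑ m, scaledChristoffel k i m * frameE e x m j) =O[l] ε :=
      Asymptotics.IsBigO.fun_sum fun m _ => (hE m j).const_mul_left _
    have h2 : (fun x => ∑ m, scaledChristoffel k j m * frameE e x i m) =O[l] ε :=
      Asymptotics.IsBigO.fun_sum fun m _ => (hE i m).const_mul_left _
    have h3 : (fun x => 2 * (if k = 2 then 1 else 0) * frameE e x i j) =O[l] ε :=
      (hE i j).const_mul_left _
    exact ((((hcov k i j).add h1).add h2).add h3).congr'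
      (hmem.mono fun x hx => (frameDE_eq hx k i j).symm) .rfl
  have hV : (fun x : Fin 3 → ℝ => 1 / x 2) =O[l] fun x => Real.exp (hDist o3 x) :=
    Asymptotics.IsBigO.of_bound 2 (hmem.mono fun x hx => by
      rw [Real.norm_of_nonneg (Real.exp_pos _).le, Real.norm_of_nonneg (by positivity)]
      exact one_div_le_exp_hDist x hx)
  have hsum : (fun x => ∑ k, ∑ i, ∑ j,
      (curvCoeff e a x k i j - flatCurvCoeff a k i j) * frameDE e x k i j)
      =O[l] fun x => ε x * ε x :=
    Asymptotics.IsBigO.fun_sum fun k _ => Asymptotics.IsBigO.fun_sum fun i _ =>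
      Asymptotics.IsBigO.fun_sum fun j _ =>
        (curvCoeff_sub_flatCurvCoeff ha' hG hε hE hc hco' k i j).mul (hD k i j)
  obtain ⟨C, hC, hbound⟩ := (hV.mul (((normal_second_order ha' hG hε hE hc hco'
    2).const_mul_left (-4)).add (hsum.const_mul_left 2))).exists_pos
  refine ⟨C, hC, fun x hx _ => ?_⟩
  have h := Asymptotics.isBigOWith_principal.1 hbound x hx
  rw [error_eq he hx (hpos x hx) hsymm ha ht₁ ht₂ ht₁₂ hat₁ hat₂]
  refine h.trans_eq ?_
  simp only [hεdef]
  rw [← Real.exp_add, ← Real.exp_add, Real.norm_of_nonneg (Real.exp_pos _).le]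
  ring_nf
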